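/- arXiv:1410.8420 — 2 statements merged into one kernel-verified Lean document; each statement's English description precedes it below -/
import Mathlib

section
/- There exist a constant c > 0 and N ∈ ℕ such that for all n ≥ N the following holds: with probability at least 1 − 2^{−n} over a uniformly random function f: {0,1}^n → {0,1} (each value an independent fair coin flip), every function g: {0,1}^n → {0,1} that is 0.01-close to f has alternation complexity a(g) ≥ c·√n. -/
/-- Number of alternations of `f` along the chain `X` of `ℓ+1` points:
the number of indices `j` with `f (X j) ≠ f (X (j+1))`. -/
def altCount {n : ℕ} (f : (Fin n → Bool) → Bool) {ℓ : ℕ}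
    (X : Fin (ℓ + 1) → (Fin n → Bool)) : ℕ :=
  (Finset.univ.filter (fun j : Fin ℓ => f (X j.castSucc) ≠ f (X j.succ))).card

/-- `a_f(x)`: the maximum number of alternations of `f` over all
(strictly increasing) chains in `{0,1}^n` starting at `x`. -/
noncomputable def altFrom {n : ℕ} (f : (Fin n → Bool) → Bool) (x : Fin n → Bool) : ℕ :=
  sSup {k | ∃ (ℓ : ℕ) (X : Fin (ℓ + 1) → (Fin n → Bool)),
    StrictMono X ∧ X 0 = x ∧ altCount f X = k}

/-- `a(f)`: the maximum number of alternations of `f` over all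
(strictly increasing) chains in `{0,1}^n`. -/
noncomputable def alt {n : ℕ} (f : (Fin n → Bool) → Bool) : ℕ :=
  sSup {k | ∃ (ℓ : ℕ) (X : Fin (ℓ + 1) → (Fin n → Bool)),
    StrictMono X ∧ altCount f X = k}

open Finset

lemma sixteen_pow_le_centralBinom_sq_mul (m : ℕ) :
    16 ^ (m + 1) ≤ Nat.centralBinom (m + 1) ^ 2 * (4 * (m + 1)) := by
  induction m with
  | zero => norm_num [Nat.centralBinom, Nat.choose]
  | succ m ih =>
    have h := Nat.succ_mul_centralBinom_succ (m + 1)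
    have h2 : ((m + 1 + 1) ^ 2 * (m + 1)) * (Nat.centralBinom (m + 1 + 1) ^ 2 * (4 * (m + 1 + 1)))
        = (Nat.centralBinom (m + 1) ^ 2 * (4 * (m + 1))) *
          (4 * (2 * (m + 1) + 1) ^ 2 * (m + 1 + 1)) := by
      calc _ = ((m + 1 + 1) * Nat.centralBinom (m + 1 + 1)) ^ 2 *
            (4 * (m + 1 + 1) * (m + 1)) := by ring
        _ = _ := by rw [h]; ring
    refine le_of_mul_le_mul_left (a := (m + 1 + 1) ^ 2 * (m + 1)) ?_ (by positivity)
    rw [h2]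
    calc _ = 16 ^ (m + 1) * (16 * (m + 1) * (m + 1 + 1) ^ 2) := by ring
      _ ≤ _ := by
        refine Nat.mul_le_mul ih ?_
        nlinarith [sq_nonneg m]

lemma four_pow_le_choose_half_sq_mul {n : ℕ} (hn : 1 ≤ n) :
    4 ^ n ≤ n.choose (n / 2) ^ 2 * (2 * (n + 1)) := by
  obtain ⟨m, rfl | rfl⟩ := Nat.even_or_odd' n
  · obtain ⟨k, rfl⟩ : ∃ k, m = k + 1 := ⟨m - 1, by omega⟩
    have h := sixteen_pow_le_centralBinom_sq_mul k
    rw [Nat.centralBinom_eq_two_mul_choose] at h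
    rw [Nat.mul_div_cancel_left _ two_pos, pow_mul]
    refine h.trans (Nat.mul_le_mul_left _ ?_)
    omega
  · have h := sixteen_pow_le_centralBinom_sq_mul m
    have h1 : Nat.centralBinom (m + 1) = 2 * (2 * m + 1).choose m := by
      rw [Nat.centralBinom_eq_two_mul_choose, show 2 * (m + 1) = 2 * m + 1 + 1 by ring,
        Nat.choose_succ_succ, Nat.choose_symm_half]
      ring
    rw [show (2 * m + 1) / 2 = m by omega]
    rw [h1] at h
    have h3 : (16 : ℕ) ^ (m + 1) = 4 * 4 ^ (2 * m + 1) := by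
      rw [show (16 : ℕ) = 4 ^ 2 by norm_num, ← pow_mul]; ring
    rw [h3] at h
    nlinarith

lemma sub_mul_choose_half_le (n d : ℕ) (hd : 2 * d ^ 2 ≤ n) :
    ((n : ℝ) - 2 * d ^ 2) * n.choose (n / 2) ≤ n * n.choose (n / 2 + d) := by
  induction d with
  | zero => simp
  | succ d ih =>
    have ih := ih ((Nat.mul_le_mul_left 2 (Nat.pow_le_pow_left d.le_succ 2)).trans hd)
    set h := n / 2
    have hh : 2 * (h : ℝ) ≤ n := by exact_mod_cast Nat.mul_div_le n 2
    have hdn : h + d ≤ n := by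
      have : 2 * d ≤ n := by nlinarith
      omega
    have hr : (n.choose (h + d + 1) : ℝ) * (h + d + 1) = n.choose (h + d) * (n - (h + d)) := by
      have := Nat.choose_succ_right_eq n (h + d)
      rw [← Nat.cast_inj (R := ℝ)] at this
      push_cast [Nat.cast_sub hdn] at this
      linarith
    have hd' : 2 * ((d : ℝ) + 1) ^ 2 ≤ n := by exact_mod_cast hd
    have hd0 : (0 : ℝ) ≤ d := d.cast_nonneg
    have hh0 : (0 : ℝ) ≤ h := h.cast_nonneg
    have hn0 : (0 : ℝ) < n := by nlinarith
    have c0 : (0 : ℝ) ≤ n.choose h := Nat.cast_nonneg _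
    have c1 : (0 : ℝ) ≤ n.choose (h + d) := Nat.cast_nonneg _
    have c2 : (0 : ℝ) ≤ n.choose (h + d + 1) := Nat.cast_nonneg _
    have step : ((n : ℝ) - (4 * d + 2)) * n.choose (h + d) ≤ n * n.choose (h + d + 1) := by
      have : ((n : ℝ) - (4 * d + 2)) * (h + d + 1) ≤ n * (n - (h + d)) := by
        nlinarith
      refine le_of_mul_le_mul_right (a := (h : ℝ) + d + 1) ?_ (by positivity)
      calc _ = (((n : ℝ) - (4 * d + 2)) * (h + d + 1)) * n.choose (h + d) := by ring
        _ ≤ (n * (n - (h + d))) * n.choose (h + d) := by gcongr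
        _ = n * (n.choose (h + d) * (n - (h + d))) := by ring
        _ = _ := by rw [← hr]; ring
    have key : ((n : ℝ) - 2 * (d + 1) ^ 2) * n ≤ (n - (4 * d + 2)) * (n - 2 * d ^ 2) := by
      nlinarith [mul_nonneg hd0 (sq_nonneg (d : ℝ)), sq_nonneg (d : ℝ)]
    have hpos : (0 : ℝ) ≤ n - (4 * d + 2) := by nlinarith
    push_cast
    rw [← add_assoc]
    refine le_of_mul_le_mul_right (a := (n : ℝ)) ?_ hn0
    calc _ = (((n : ℝ) - 2 * (d + 1) ^ 2) * n) * n.choose h := by ring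
      _ ≤ ((n - (4 * d + 2)) * (n - 2 * d ^ 2)) * n.choose h := by gcongr
      _ = (n - (4 * d + 2)) * ((n - 2 * d ^ 2) * n.choose h) := by ring
      _ ≤ (n - (4 * d + 2)) * (n * n.choose (h + d)) := by gcongr
      _ = n * ((n - (4 * d + 2)) * n.choose (h + d)) := by ring
      _ ≤ n * (n * n.choose (h + d + 1)) := by gcongr
      _ = _ := by ring

/-- Binomial coefficients within `√n / 5` of the middle are at least `2 ^ n / (2 √n)`. -/
lemma two_pow_le_two_sqrt_mul_choose {n d : ℕ} (hn : 2 ≤ n) (hd : 25 * d ^ 2 ≤ n) :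
    (2 : ℝ) ^ n ≤ 2 * √n * n.choose (n / 2 + d) := by
  have h1 := sub_mul_choose_half_le n d (by nlinarith)
  have h2 : (4 : ℝ) ^ n ≤ n.choose (n / 2) ^ 2 * (2 * (n + 1)) := by
    exact_mod_cast four_pow_le_choose_half_sq_mul (by omega : 1 ≤ n)
  have hd' : 25 * (d : ℝ) ^ 2 ≤ n := by exact_mod_cast hd
  have hn' : (2 : ℝ) ≤ n := by exact_mod_cast hn
  have c0 : (0 : ℝ) ≤ n.choose (n / 2) := Nat.cast_nonneg _
  set C : ℝ := (n.choose (n / 2) : ℝ)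
  set E : ℝ := (n.choose (n / 2 + d) : ℝ)
  have h3 : 0.92 * C ≤ E := by
    refine le_of_mul_le_mul_left (a := (n : ℝ)) ?_ (by linarith)
    nlinarith
  have h4 : (0.92 * C) ^ 2 ≤ E ^ 2 := by gcongr
  have hE : 0 ≤ 2 * √n * E := mul_nonneg (by positivity) (Nat.cast_nonneg _)
  refine (sq_le_sq₀ (by positivity) hE).mp ?_
  rw [mul_pow, mul_pow, Real.sq_sqrt (by positivity), ← pow_mul, mul_comm n, pow_mul]
  norm_num
  refine h2.trans ?_
  have : C ^ 2 * (2 * (n + 1)) ≤ 4 * n * (0.92 * C) ^ 2 := by nlinarith [sq_nonneg C]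
  refine this.trans ?_
  exact mul_le_mul_of_nonneg_left h4 (by positivity)

lemma factorial_mul_factorial_le {n d : ℕ} (hn : 2 ≤ n) (hd : 25 * d ^ 2 ≤ n) :
    (((n / 2 + d).factorial * (n - (n / 2 + d)).factorial : ℕ) : ℝ) ≤
      n.factorial * (2 * √n / 2 ^ n) := by
  have h := two_pow_le_two_sqrt_mul_choose hn hd
  have hle : n / 2 + d ≤ n := by
    have : 2 * d ≤ n := by nlinarith
    omega
  have h2 := Nat.choose_mul_factorial_mul_factorial hle
  rw [← h2, ← mul_div_assoc, le_div_iff₀ (by positivity)]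
  push_cast
  nlinarith [mul_le_mul_of_nonneg_left h (show (0 : ℝ) ≤
    (n / 2 + d).factorial * (n - (n / 2 + d)).factorial by positivity)]

/-- The sign `±1` of a Boolean. -/
def boolSign (b : Bool) : ℝ := if b then 1 else -1

lemma boolSign_not (b : Bool) : boolSign (!b) = -boolSign b := by
  cases b <;> simp [boolSign]

lemma abs_boolSign (b : Bool) : |boolSign b| = 1 := by
  cases b <;> simp [boolSign]

lemma ite_ne_eq_boolSign (a b : Bool) :
    (if a ≠ b then (1 : ℝ) else 0) = (1 - boolSign a * boolSign b) / 2 := by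
  cases a <;> cases b <;> norm_num [boolSign]

/-- Exponential moment of a random signed sum `∑ y ∈ T, ± A y` whose coefficients are bounded
by `a` and do not depend on the values of `f` on `T`. -/
lemma sum_exp_signed_sum_le {V : Type*} [Fintype V] [DecidableEq V] (T : Finset V)
    (A : V → (V → Bool) → ℝ) (a : ℝ)
    (hA : ∀ y, ∀ z ∈ T, ∀ f, A y (Function.update f z (!f z)) = A y f)
    (ha : ∀ y f, |A y f| ≤ a) :
    ∑ f : V → Bool, Real.exp (∑ y ∈ T, boolSign (f y) * A y f) ≤
      Real.exp (a ^ 2 / 2 * #T) * 2 ^ Fintype.card V := by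
  induction T using Finset.induction_on with
  | empty => simp
  | insert z T hz ih =>
    have ih := ih fun y w hw => hA y w (mem_insert_of_mem hw)
    let flip : (V → Bool) → (V → Bool) := fun f => Function.update f z (!f z)
    have hflip : Function.Involutive flip := fun f => by simp [flip]
    set G : (V → Bool) → ℝ := fun f =>
      Real.exp (∑ y ∈ insert z T, boolSign (f y) * A y f) with hG
    set R : (V → Bool) → ℝ := fun f => ∑ y ∈ T, boolSign (f y) * A y f with hR
    have hGf : ∀ f, G f = Real.exp (boolSign (f z) * A z f) * Real.exp (R f) := fun f => by
      rw [hG, ← Real.exp_add]; simp only [hR]; rw [sum_insert hz]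
    have hRflip : ∀ f, R (flip f) = R f := fun f => by
      refine sum_congr rfl fun y hy => ?_
      rw [hA y z (mem_insert_self z T)]
      have hyz : y ≠ z := fun h => hz (h ▸ hy)
      simp [flip, hyz]
    have hGflip : ∀ f, G (flip f) = Real.exp (-(boolSign (f z) * A z f)) * Real.exp (R f) :=
      fun f => by
      rw [hGf, hRflip, hA z z (mem_insert_self z T)]
      simp [flip, boolSign_not]
    have hsum : ∑ f, G (flip f) = ∑ f, G f := hflip.bijective.sum_comp G
    have hpair : ∀ f, G f + G (flip f) ≤ 2 * (Real.exp (a ^ 2 / 2) * Real.exp (R f)) := fun f => by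
      have h1 := Real.cosh_le_exp_half_sq (boolSign (f z) * A z f)
      have h2 : (boolSign (f z) * A z f) ^ 2 ≤ a ^ 2 := by
        rw [← sq_abs, abs_mul, abs_boolSign, one_mul]
        exact pow_le_pow_left₀ (abs_nonneg _) (ha z f) 2
      have h3 : Real.exp ((boolSign (f z) * A z f) ^ 2 / 2) ≤ Real.exp (a ^ 2 / 2) := by gcongr
      rw [Real.cosh_eq] at h1
      rw [hGf, hGflip, ← add_mul, ← mul_assoc]
      refine mul_le_mul_of_nonneg_right ?_ (Real.exp_pos _).le
      linarith
    have htot : 2 * ∑ f, G f ≤ 2 * (Real.exp (a ^ 2 / 2) * ∑ f, Real.exp (R f)) := by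
      calc 2 * ∑ f, G f = ∑ f, (G f + G (flip f)) := by rw [sum_add_distrib, hsum]; ring
        _ ≤ ∑ f, 2 * (Real.exp (a ^ 2 / 2) * Real.exp (R f)) := sum_le_sum fun f _ => hpair f
        _ = _ := by simp only [mul_sum]
    have hexp : Real.exp (a ^ 2 / 2 * #(insert z T)) =
        Real.exp (a ^ 2 / 2) * Real.exp (a ^ 2 / 2 * #T) := by
      rw [← Real.exp_add, card_insert_of_notMem hz]; push_cast; ring_nf
    rw [hexp, mul_assoc]
    have := mul_le_mul_of_nonneg_left ih (Real.exp_pos (a ^ 2 / 2)).le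
    change ∑ f, G f ≤ _
    linarith

/-- The indicator of the first `j` elements in the numbering `σ`. -/
def prefixPoint {n : ℕ} (σ : Numbering (Fin n)) (j : ℕ) : Fin n → Bool :=
  fun a => decide ((σ a : ℕ) < j)

/-- The number of ones of a point of the cube. -/
def weight {n : ℕ} (x : Fin n → Bool) : ℕ := #{a | x a = true}

lemma weight_prefixPoint {n : ℕ} (σ : Numbering (Fin n)) {j : ℕ} (hj : j ≤ n) :
    weight (prefixPoint σ j) = j := by
  have hc : Fintype.card (Fin n) = n := Fintype.card_fin n
  rw [weight, ← card_map σ.toEmbedding]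
  have : ({a | prefixPoint σ j a = true} : Finset (Fin n)).map σ.toEmbedding
      = ({b | (b : ℕ) < j} : Finset (Fin (Fintype.card (Fin n)))) := by
    ext b
    simp [prefixPoint]
  rw [this, Fin.card_filter_val_lt]
  omega

lemma card_prefixPoint_eq {n : ℕ} (x : Fin n → Bool) :
    #{σ : Numbering (Fin n) | prefixPoint σ (weight x) = x} =
      (weight x).factorial * (n - weight x).factorial := by
  have h := Numbering.card_prefixed ({a | x a = true} : Finset (Fin n))
  rw [Fintype.card_fin] at h
  rw [weight, ← h]
  congr 1
  ext σ
  simp only [mem_filter, mem_univ, true_and, Numbering.mem_prefixed, Numbering.IsPrefix,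
    funext_iff, prefixPoint]
  refine forall_congr' fun a => ?_
  cases x a <;> simp

/-- The numberings passing through `x` at one of the levels in `J` number at most `B`. -/
lemma sum_card_prefixPoint_le {n : ℕ} {J : Finset ℕ} {B : ℝ} (hB0 : 0 ≤ B)
    (hJ : ∀ j ∈ J, j ≤ n) (hB : ∀ j ∈ J, ((j.factorial * (n - j).factorial : ℕ) : ℝ) ≤ B)
    (x : Fin n → Bool) :
    ∑ j ∈ J, (#{σ : Numbering (Fin n) | prefixPoint σ j = x} : ℝ) ≤ B := by
  have hzero : ∀ j ∈ J, j ≠ weight x →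
      (#{σ : Numbering (Fin n) | prefixPoint σ j = x} : ℝ) = 0 := fun j hj hne => by
    rw [Nat.cast_eq_zero, card_eq_zero, filter_eq_empty_iff]
    rintro σ - rfl
    exact hne (weight_prefixPoint σ (hJ j hj)).symm
  by_cases hw : weight x ∈ J
  · rw [sum_eq_single_of_mem _ hw hzero, card_prefixPoint_eq]
    exact hB _ hw
  · rw [sum_eq_zero fun j hj => hzero j hj fun h => hw (h ▸ hj)]
    exact hB0

lemma strictMono_prefixPoint {n : ℕ} (σ : Numbering (Fin n)) :
    StrictMono fun j : Fin (n + 1) => prefixPoint σ j := by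
  have hle : ∀ i j : ℕ, i ≤ j → prefixPoint σ i ≤ prefixPoint σ j := fun i j hij a => by
    simp only [prefixPoint, Bool.le_iff_imp, decide_eq_true_eq]
    exact fun h => h.trans_le hij
  intro i j hij
  refine lt_of_le_of_ne (hle i j (le_of_lt hij)) fun h => ?_
  have h' := congrArg weight h
  simp only [weight_prefixPoint σ (Nat.lt_succ_iff.mp i.2),
    weight_prefixPoint σ (Nat.lt_succ_iff.mp j.2)] at h'
  exact hij.ne (Fin.ext h')

lemma altCount_le_alt {n ℓ : ℕ} (f : (Fin n → Bool) → Bool) (X : Fin (ℓ + 1) → (Fin n → Bool))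
    (hX : StrictMono X) : altCount f X ≤ alt f := by
  refine le_csSup ⟨2 ^ n, ?_⟩ ⟨ℓ, X, hX, rfl⟩
  rintro _ ⟨ℓ, X, hX, rfl⟩
  have h := Fintype.card_le_of_injective X hX.injective
  simp only [Fintype.card_fin, Fintype.card_fun, Fintype.card_bool] at h
  refine (card_filter_le _ _).trans ?_
  simp
  omega

/-- Alternations along the disjoint steps `m + 2k → m + 2k + 1` of a maximal chain. -/
lemma sum_ite_le_alt {n m ℓ : ℕ} (h : m + 2 * ℓ ≤ n) (g : (Fin n → Bool) → Bool)
    (σ : Numbering (Fin n)) :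
    ∑ k ∈ range ℓ,
      (if g (prefixPoint σ (m + 2 * k)) ≠ g (prefixPoint σ (m + 2 * k + 1)) then (1 : ℝ) else 0) ≤
      alt g := by
  rw [← sum_filter, sum_const, nsmul_eq_mul, mul_one, Nat.cast_le]
  refine le_trans ?_ (altCount_le_alt g _ (strictMono_prefixPoint σ))
  refine le_trans (card_le_card ?_) (card_image_le (f := fun j : Fin n => ((j : ℕ) - m) / 2))
  intro k hk
  simp only [mem_filter, mem_range] at hk
  refine mem_image.mpr ⟨⟨m + 2 * k, by omega⟩, ?_, ?_⟩
  · simpa using hk.2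
  · simp

lemma sum_range_pairs {M : Type*} [AddCommMonoid M] (φ : ℕ → M) (m ℓ : ℕ) :
    ∑ k ∈ range ℓ, (φ (m + 2 * k) + φ (m + 2 * k + 1)) = ∑ j ∈ Ico m (m + 2 * ℓ), φ j := by
  induction ℓ with
  | zero => simp
  | succ ℓ ih =>
    rw [sum_range_succ, ih, show m + 2 * (ℓ + 1) = m + 2 * ℓ + 1 + 1 by ring,
      sum_Ico_succ_top (by omega), sum_Ico_succ_top (by omega)]
    exact (add_assoc _ _ _).symm

lemma sum_ite_ne_prefixPoint_le {n : ℕ} {J : Finset ℕ} {B : ℝ} (hB0 : 0 ≤ B)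
    (hJ : ∀ j ∈ J, j ≤ n) (hB : ∀ j ∈ J, ((j.factorial * (n - j).factorial : ℕ) : ℝ) ≤ B)
    (f g : (Fin n → Bool) → Bool) :
    ∑ σ : Numbering (Fin n), ∑ j ∈ J,
      (if f (prefixPoint σ j) ≠ g (prefixPoint σ j) then (1 : ℝ) else 0) ≤
      B * #{x | f x ≠ g x} := by
  have h : ∀ (σ : Numbering (Fin n)) (j : ℕ),
      (if f (prefixPoint σ j) ≠ g (prefixPoint σ j) then (1 : ℝ) else 0) =
        ∑ x ∈ ({x | f x ≠ g x} : Finset (Fin n → Bool)),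
          if prefixPoint σ j = x then 1 else 0 := fun σ j => by
    rw [sum_ite_eq]
    simp
  simp_rw [h]
  rw [sum_comm]
  simp_rw [sum_comm (s := univ (α := Numbering (Fin n)))]
  rw [sum_comm, mul_comm, ← nsmul_eq_mul, ← sum_const]
  refine sum_le_sum fun x _ => ?_
  simpa [sum_boole] using sum_card_prefixPoint_le hB0 hJ hB x

/-- The unnormalized correlation of consecutive values of `f` along the steps
`m + 2k → m + 2k + 1` of a random maximal chain. -/
noncomputable def chainCorr {n : ℕ} (m ℓ : ℕ) (f : (Fin n → Bool) → Bool) : ℝ :=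
  ∑ k ∈ range ℓ, ∑ σ : Numbering (Fin n),
    boolSign (f (prefixPoint σ (m + 2 * k))) * boolSign (f (prefixPoint σ (m + 2 * k + 1)))

/-- A function close to one with small chain correlation has many alternations. -/
lemma sub_le_factorial_mul_alt {n m ℓ : ℕ} (hℓ : m + 2 * ℓ ≤ n) {B : ℝ} (hB0 : 0 ≤ B)
    (hB : ∀ j ∈ Ico m (m + 2 * ℓ), ((j.factorial * (n - j).factorial : ℕ) : ℝ) ≤ B)
    (f g : (Fin n → Bool) → Bool) :
    (n.factorial * ℓ - chainCorr m ℓ f) / 2 - B * #{x | f x ≠ g x} ≤ n.factorial * alt g := by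
  have hcard : Fintype.card (Numbering (Fin n)) = n.factorial := by simp
  have hD := sum_ite_ne_prefixPoint_le hB0
    (fun j hj => by have := (mem_Ico.mp hj).2; omega) hB f g
  have halt := sum_le_sum fun σ (_ : σ ∈ univ (α := Numbering (Fin n))) => sum_ite_le_alt hℓ g σ
  rw [sum_const, card_univ, hcard, nsmul_eq_mul] at halt
  refine le_trans ?_ halt
  have hcorr : (n.factorial * ℓ - chainCorr m ℓ f) / 2 = ∑ σ : Numbering (Fin n), ∑ k ∈ range ℓ,
      (if f (prefixPoint σ (m + 2 * k)) ≠ f (prefixPoint σ (m + 2 * k + 1))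
        then (1 : ℝ) else 0) := by
    simp_rw [ite_ne_eq_boolSign]
    rw [sum_comm]
    simp_rw [← sum_div, sum_sub_distrib]
    rw [chainCorr]
    simp [mul_comm]
  rw [hcorr, sub_le_iff_le_add]
  refine le_trans ?_ (add_le_add_right hD _)
  rw [← sum_add_distrib]
  refine sum_le_sum fun σ _ => ?_
  rw [← sum_range_pairs, ← sum_add_distrib]
  refine sum_le_sum fun k _ => ?_
  cases f (prefixPoint σ (m + 2 * k)) <;> cases f (prefixPoint σ (m + 2 * k + 1)) <;>
    cases g (prefixPoint σ (m + 2 * k)) <;> cases g (prefixPoint σ (m + 2 * k + 1)) <;> norm_num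

/-- Exponential moment of the chain correlation of a uniformly random function. -/
lemma sum_exp_chainCorr_le {n m ℓ : ℕ} (hℓ : m + 2 * ℓ ≤ n) {B μ : ℝ} (hB0 : 0 ≤ B) (hμ : 0 ≤ μ)
    (hB : ∀ j ∈ Ico m (m + 2 * ℓ), ((j.factorial * (n - j).factorial : ℕ) : ℝ) ≤ B) :
    ∑ f : (Fin n → Bool) → Bool, Real.exp (μ * chainCorr m ℓ f) ≤
      Real.exp ((μ * B) ^ 2 / 2 * 2 ^ n) * 2 ^ 2 ^ n := by
  set T : Finset (Fin n → Bool) := {y | weight y % 2 = (m + 1) % 2} with hT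
  set A : (Fin n → Bool) → ((Fin n → Bool) → Bool) → ℝ := fun y f =>
    μ * ∑ k ∈ range ℓ, ∑ σ : Numbering (Fin n),
      (if prefixPoint σ (m + 2 * k + 1) = y then 1 else 0) *
        boolSign (f (prefixPoint σ (m + 2 * k))) with hA
  have hinv : ∀ y, ∀ z ∈ T, ∀ f, A y (Function.update f z (!f z)) = A y f := fun y z hz f => by
    simp only [hA]
    congr 1
    refine sum_congr rfl fun k hk => sum_congr rfl fun σ _ => ?_
    rw [Function.update_of_ne]
    rintro rfl
    rw [hT, mem_filter, weight_prefixPoint σ (by have := mem_range.mp hk; omega)] at hz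
    omega
  have habs : ∀ y f, |A y f| ≤ μ * B := fun y f => by
    simp only [hA]
    rw [abs_mul, abs_of_nonneg hμ]
    refine mul_le_mul_of_nonneg_left ?_ hμ
    set J : Finset ℕ := (range ℓ).image fun k => m + 2 * k + 1 with hJ
    have hJI : ∀ j ∈ J, j ∈ Ico m (m + 2 * ℓ) := fun j hj => by
      obtain ⟨k, hk, rfl⟩ := mem_image.mp hj
      have := mem_range.mp hk
      exact mem_Ico.mpr ⟨by omega, by omega⟩
    have h := sum_card_prefixPoint_le hB0
      (fun j hj => by have := (mem_Ico.mp (hJI j hj)).2; omega) (fun j hj => hB j (hJI j hj)) y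
    rw [hJ, sum_image (fun a _ b _ hab => by omega)] at h
    refine le_trans ((abs_sum_le_sum_abs _ _).trans (sum_le_sum fun k _ => ?_)) h
    refine (abs_sum_le_sum_abs _ _).trans ?_
    simp_rw [abs_mul, abs_boolSign, mul_one]
    rw [← sum_boole]
    refine sum_le_sum fun σ _ => ?_
    split_ifs <;> simp
  have hsum : ∀ f, ∑ y ∈ T, boolSign (f y) * A y f = μ * chainCorr m ℓ f := fun f => by
    simp only [hA, chainCorr]
    simp_rw [mul_left_comm _ μ, ← mul_sum]
    congr 1
    simp_rw [mul_sum]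
    rw [sum_comm]
    refine sum_congr rfl fun k hk => ?_
    rw [sum_comm]
    refine sum_congr rfl fun σ _ => ?_
    have hmem : prefixPoint σ (m + 2 * k + 1) ∈ T := by
      rw [hT, mem_filter, weight_prefixPoint σ (by have := mem_range.mp hk; omega)]
      exact ⟨mem_univ _, by omega⟩
    rw [sum_eq_single_of_mem _ hmem fun y _ hy => by rw [if_neg (Ne.symm hy)]; simp]
    simp [mul_comm]
  have h := sum_exp_signed_sum_le T A (μ * B) hinv habs
  simp_rw [hsum] at h
  have hV : Fintype.card (Fin n → Bool) = 2 ^ n := by simp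
  rw [hV] at h
  refine h.trans (mul_le_mul_of_nonneg_right (Real.exp_le_exp.mpr ?_) (by positivity))
  refine mul_le_mul_of_nonneg_left ?_ (by positivity)
  exact_mod_cast (card_le_univ T).trans_eq hV

lemma card_lt_chainCorr_le {n m ℓ : ℕ} (hℓ : m + 2 * ℓ ≤ n) {B μ : ℝ} (t : ℝ) (hB0 : 0 ≤ B)
    (hμ : 0 ≤ μ)
    (hB : ∀ j ∈ Ico m (m + 2 * ℓ), ((j.factorial * (n - j).factorial : ℕ) : ℝ) ≤ B) :
    (#{f : (Fin n → Bool) → Bool | t < chainCorr m ℓ f} : ℝ) ≤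
      Real.exp ((μ * B) ^ 2 / 2 * 2 ^ n - μ * t) * 2 ^ 2 ^ n := by
  have h := sum_exp_chainCorr_le hℓ hB0 hμ hB
  rw [Real.exp_sub, div_mul_eq_mul_div, le_div_iff₀ (Real.exp_pos _)]
  refine le_trans ?_ h
  rw [← nsmul_eq_mul, ← sum_const]
  refine le_trans (sum_le_sum fun f hf => ?_)
    (sum_le_sum_of_subset_of_nonneg (filter_subset _ _) fun f _ _ => (Real.exp_pos _).le)
  exact Real.exp_le_exp.mpr (mul_le_mul_of_nonneg_left (mem_filter.mp hf).2.le hμ)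

lemma mul_le_two_pow {n : ℕ} (hn : 30 ≤ n) : 80000 * n ≤ 2 ^ n := by
  induction n, hn using Nat.le_induction with
  | base => norm_num
  | succ n hn ih => rw [pow_succ]; omega

open scoped Classical in
/-- There are `c > 0` and `N` such that for all `n ≥ N`: with probability at least
`1 - 2^{-n}` over a uniformly random `f : {0,1}^n → {0,1}`, every `g` that is
`0.01`-close to `f` has alternation complexity `a(g) ≥ c √n`. -/
theorem stmt9 :
    ∃ (c : ℝ) (N : ℕ), 0 < c ∧ ∀ n : ℕ, N ≤ n →
      1 - ((2 : ℝ) ^ n)⁻¹ ≤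
        ((Finset.univ.filter (fun f : (Fin n → Bool) → Bool =>
            ∀ g : (Fin n → Bool) → Bool,
              ((Finset.univ.filter (fun x : Fin n → Bool => f x ≠ g x)).card : ℝ) / 2 ^ n
                  ≤ 0.01 →
                c * Real.sqrt n ≤ (alt g : ℝ))).card : ℝ) / 2 ^ (2 ^ n) := by
  refine ⟨0.02, 12100, by norm_num, fun n hn => ?_⟩
  set r : ℝ := √n with hr
  have hr2 : r ^ 2 = n := Real.sq_sqrt (Nat.cast_nonneg n)
  have hr110 : 110 ≤ r := by
    rw [hr]
    refine Real.le_sqrt_of_sq_le ?_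
    have : (12100 : ℝ) ≤ n := by exact_mod_cast hn
    linarith
  set ℓ : ℕ := ⌊r / 10⌋₊
  have hℓ1 : (ℓ : ℝ) ≤ r / 10 := Nat.floor_le (by positivity)
  have hℓ2 : r / 11 ≤ ℓ := by
    have := Nat.lt_floor_add_one (r / 10)
    linarith
  have hℓn : 100 * ℓ ^ 2 ≤ n := by
    have : 100 * (ℓ : ℝ) ^ 2 ≤ n := by nlinarith [Nat.cast_nonneg (α := ℝ) ℓ]
    exact_mod_cast this
  have hℓ : n / 2 + 2 * ℓ ≤ n := by
    have : 4 * ℓ ≤ n := by nlinarith [Nat.le_self_pow two_ne_zero ℓ]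
    omega
  set F : ℝ := (n.factorial : ℝ)
  have hF : 0 < F := Nat.cast_pos.mpr n.factorial_pos
  set B : ℝ := F * (2 * r / 2 ^ n) with hBdef
  have hB0 : 0 ≤ B := by positivity
  have hB : ∀ j ∈ Ico (n / 2) (n / 2 + 2 * ℓ),
      ((j.factorial * (n - j).factorial : ℕ) : ℝ) ≤ B := fun j hj => by
    rw [mem_Ico] at hj
    obtain ⟨d, rfl⟩ := Nat.exists_eq_add_of_le hj.1
    refine factorial_mul_factorial_le (by omega) ?_
    have : d ≤ 2 * ℓ := by omega
    nlinarith
  have hbad := card_lt_chainCorr_le (μ := 2 ^ n / (400 * r * F)) hℓ (F * r / 100) hB0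
    (by positivity) hB
  have hexp : (2 ^ n / (400 * r * F) * B) ^ 2 / 2 * 2 ^ n -
      2 ^ n / (400 * r * F) * (F * r / 100) = -(2 ^ n / 80000) := by
    rw [hBdef]
    field_simp
    ring
  have hsmall : Real.exp (-(2 ^ n / 80000)) ≤ ((2 : ℝ) ^ n)⁻¹ := by
    rw [Real.exp_neg]
    refine inv_anti₀ (by positivity) ?_
    have h1 : 80000 * (n : ℝ) ≤ 2 ^ n := by exact_mod_cast mul_le_two_pow (by omega : 30 ≤ n)
    have h2 : (2 : ℝ) ≤ Real.exp 1 := by linarith [Real.add_one_le_exp 1]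
    calc (2 : ℝ) ^ n ≤ Real.exp 1 ^ n := by gcongr
      _ = Real.exp n := by rw [← Real.exp_nat_mul, mul_one]
      _ ≤ _ := Real.exp_le_exp.mpr (by linarith)
  rw [hexp] at hbad
  have hcount := card_filter_add_card_filter_not (s := univ (α := (Fin n → Bool) → Bool))
    (fun f => F * r / 100 < chainCorr (n / 2) ℓ f)
  have hV : #(univ (α := (Fin n → Bool) → Bool)) = 2 ^ 2 ^ n := by simp
  rw [hV, ← Nat.cast_inj (R := ℝ)] at hcount
  push_cast at hcount
  have hpos : (0 : ℝ) < 2 ^ 2 ^ n := by positivity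
  have hbad' := hbad.trans (mul_le_mul_of_nonneg_right hsmall hpos.le)
  rw [le_div_iff₀ hpos, sub_mul, one_mul]
  refine le_trans (b := (#{f : (Fin n → Bool) → Bool |
    ¬ F * r / 100 < chainCorr (n / 2) ℓ f} : ℝ)) (by linarith) ?_
  refine Nat.cast_le.mpr (card_le_card fun f hf => ?_)
  simp only [mem_filter, mem_univ, true_and, not_lt] at hf ⊢
  intro g hg
  have h := sub_le_factorial_mul_alt hℓ hB0 hB f g
  rw [div_le_iff₀ (by positivity)] at hg
  have hBD : B * #{x | f x ≠ g x} ≤ F * (0.02 * r) := by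
    calc B * #{x | f x ≠ g x} ≤ B * (0.01 * 2 ^ n) := by
          refine mul_le_mul_of_nonneg_left ?_ hB0
          convert hg
      _ = F * (0.02 * r) := by rw [hBdef]; field_simp; norm_num
  refine le_of_mul_le_mul_left (a := F) ?_ hF
  nlinarith [mul_le_mul_of_nonneg_left hℓ2 hF.le, mul_pos hF (by linarith : 0 < r)]
end

section
/- Let f: {0,1}^n → {0,1}, δ ∈ [0, 1/2], and s ∈ [0,1]. If NS_{1−2δ}(f) ≤ 1 − s, then ExpBias_{2δ}(f) ≤ 1 − s/4. -/
/-- Noise stability `NS_η(f) = 1 - 2 Pr[f(x) ≠ f(y)]` where `x` is uniform and `y` is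
`η`-correlated with `x`: here `z` records which coordinates are flipped, each coordinate
being flipped independently with probability `(1 - η)/2`. -/
noncomputable def noiseStability {n : ℕ} (η : ℝ) (f : (Fin n → Bool) → Bool) : ℝ :=
  1 - 2 * ∑ x : Fin n → Bool, ∑ z : Fin n → Bool,
      ((2 ^ n : ℝ))⁻¹ * (∏ i : Fin n, if z i then (1 - η) / 2 else (1 + η) / 2) *
        (if f x ≠ f (fun i => xor (x i) (z i)) then 1 else 0)

/-- The probability that a random restriction `ρ` (each coordinate independently left
free with probability `δ`, else set to `0` or `1` each with probability `(1-δ)/2`)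
equals the given restriction `ρ : Fin n → Option Bool` (`none` = free). -/
noncomputable def restrictionWeight {n : ℕ} (δ : ℝ) (ρ : Fin n → Option Bool) : ℝ :=
  ∏ i : Fin n, (match ρ i with | none => δ | some _ => (1 - δ) / 2)

/-- `bias(f_ρ) = max (Pr[f_ρ = 1], Pr[f_ρ = 0])` where the probability is over a uniform
assignment of the free coordinates of the restriction `ρ` (filling all coordinates
uniformly and overriding the fixed ones gives the same distribution). -/
noncomputable def restrictedBias {n : ℕ} (ρ : Fin n → Option Bool) (f : (Fin n → Bool) → Bool) : ℝ :=
  max (((Finset.univ.filter (fun y : Fin n → Bool =>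
          f (fun i => (ρ i).getD (y i)) = true)).card : ℝ) / 2 ^ n)
      (((Finset.univ.filter (fun y : Fin n → Bool =>
          f (fun i => (ρ i).getD (y i)) = false)).card : ℝ) / 2 ^ n)

/-- `ExpBias_δ(f) = E_ρ[bias(f_ρ)]` over a random restriction `ρ` at rate `δ`. -/
noncomputable def expBias {n : ℕ} (δ : ℝ) (f : (Fin n → Bool) → Bool) : ℝ :=
  ∑ ρ : Fin n → Option Bool, restrictionWeight δ ρ * restrictedBias ρ f

lemma restrictionWeight_nonneg {n : ℕ} {δ : ℝ} (h0 : 0 ≤ δ) (h1 : δ ≤ 1)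
    (ρ : Fin n → Option Bool) : 0 ≤ restrictionWeight δ ρ := by
  refine Finset.prod_nonneg fun i _ => ?_
  cases ρ i
  · exact h0
  · exact div_nonneg (sub_nonneg.2 h1) zero_le_two

lemma sum_restrictionWeight (n : ℕ) (δ : ℝ) :
    ∑ ρ : Fin n → Option Bool, restrictionWeight δ ρ = 1 := by
  have key := Finset.prod_univ_sum (fun _ : Fin n => (Finset.univ : Finset (Option Bool)))
    (fun _ o => (match o with | none => δ | some _ => (1 - δ) / 2 : ℝ))
  rw [Fintype.piFinset_univ] at key
  unfold restrictionWeight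
  rw [← key]
  refine Finset.prod_eq_one fun i _ => ?_
  rw [Fintype.sum_option, Fintype.sum_bool]
  ring

lemma sum_mul_apply_eq_sum_indicator {n : ℕ} {Ω : Type*} [Fintype Ω] (W : Ω → ℝ)
    (A B : Ω → Fin n → Bool) (g : (Fin n → Bool) → (Fin n → Bool) → ℝ) :
    ∑ ω, W ω * g (A ω) (B ω) = ∑ u : Fin n → Bool, ∑ v : Fin n → Bool,
      g u v * ∑ ω, W ω * ∏ i, (if A ω i = u i ∧ B ω i = v i then 1 else 0) := by
  have h : ∀ (ω : Ω) (u v : Fin n → Bool),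
      (∏ i, (if A ω i = u i ∧ B ω i = v i then 1 else 0) : ℝ) =
        if (A ω, B ω) = (u, v) then 1 else 0 := by
    intro ω u v
    rw [Finset.prod_ite_zero]
    simp only [Finset.prod_const_one, Finset.mem_univ, true_imp_iff, forall_and, funext_iff,
      Prod.mk.injEq]
  simp only [h]
  rw [← Fintype.sum_prod_type' (f := fun u v => g u v * ∑ ω, W ω *
    (if (A ω, B ω) = (u, v) then 1 else 0))]
  simp only [Finset.mul_sum]
  rw [Finset.sum_comm]
  refine Finset.sum_congr rfl fun ω _ => ?_
  simp only [mul_ite, mul_one, mul_zero, Prod.mk.eta, Finset.sum_ite_eq, Finset.mem_univ, if_true]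
  ring

lemma sum_pi_prod₂ {n : ℕ} {α β : Type*} [Fintype α] [Fintype β]
    (F : Fin n → α → β → ℝ) :
    ∑ a : Fin n → α, ∑ b : Fin n → β, ∏ i, F i (a i) (b i) = ∏ i, ∑ a, ∑ b, F i a b := by
  classical
  simp only [Finset.prod_univ_sum, Fintype.piFinset_univ]

lemma sum_pi_prod₃ {n : ℕ} {α β γ : Type*} [Fintype α] [Fintype β] [Fintype γ]
    (F : Fin n → α → β → γ → ℝ) :
    ∑ a : Fin n → α, ∑ b : Fin n → β, ∑ c : Fin n → γ, ∏ i, F i (a i) (b i) (c i) =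
      ∏ i, ∑ a, ∑ b, ∑ c, F i a b c := by
  classical
  simp only [Finset.prod_univ_sum, Fintype.piFinset_univ]

/-- Two independent completions of a random restriction at rate `2δ` form a
`(1 - 2δ)`-correlated pair. -/
lemma sum_restriction_eq_sum_noise {n : ℕ} (δ : ℝ)
    (g : (Fin n → Bool) → (Fin n → Bool) → ℝ) :
    ∑ ρ : Fin n → Option Bool, ∑ y : Fin n → Bool, ∑ y' : Fin n → Bool,
      (restrictionWeight (2 * δ) ρ * ∏ _i : Fin n, (1 / 4 : ℝ)) *
        g (fun i => (ρ i).getD (y i)) (fun i => (ρ i).getD (y' i)) =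
    ∑ x : Fin n → Bool, ∑ z : Fin n → Bool,
      ((2 ^ n : ℝ))⁻¹ * (∏ i : Fin n, if z i then (1 - (1 - 2 * δ)) / 2
        else (1 + (1 - 2 * δ)) / 2) * g x (fun i => xor (x i) (z i)) := by
  have hL := sum_mul_apply_eq_sum_indicator
    (fun ω : (Fin n → Option Bool) × (Fin n → Bool) × (Fin n → Bool) =>
      restrictionWeight (2 * δ) ω.1 * ∏ _i : Fin n, (1 / 4 : ℝ))
    (fun ω i => (ω.1 i).getD (ω.2.1 i)) (fun ω i => (ω.1 i).getD (ω.2.2 i)) g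
  have hR := sum_mul_apply_eq_sum_indicator
    (fun ω : (Fin n → Bool) × (Fin n → Bool) =>
      ((2 ^ n : ℝ))⁻¹ * (∏ i : Fin n, if ω.2 i then (1 - (1 - 2 * δ)) / 2
        else (1 + (1 - 2 * δ)) / 2))
    (fun ω => ω.1) (fun ω i => xor (ω.1 i) (ω.2 i)) g
  simp only [Fintype.sum_prod_type (α₁ := Fin n → Option Bool),
    Fintype.sum_prod_type (α₁ := Fin n → Bool)] at hL hR
  rw [hL, hR]
  refine Finset.sum_congr rfl fun u _ => Finset.sum_congr rfl fun v _ => ?_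
  congr 1
  have h2 : ((2 ^ n : ℝ))⁻¹ = ∏ _i : Fin n, (1 / 2 : ℝ) := by simp
  simp only [h2, restrictionWeight, ← Finset.prod_mul_distrib]
  rw [sum_pi_prod₃ (fun i (o : Option Bool) (b c : Bool) =>
      ((match o with | none => 2 * δ | some _ => (1 - 2 * δ) / 2) * (1 / 4 : ℝ) *
            if o.getD b = u i ∧ o.getD c = v i then 1 else 0)),
    sum_pi_prod₂ (fun i (b c : Bool) =>
      ((1 / 2 : ℝ) * (if c then (1 - (1 - 2 * δ)) / 2 else (1 + (1 - 2 * δ)) / 2) *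
            if b = u i ∧ xor b c = v i then 1 else 0))]
  refine Finset.prod_congr rfl fun i _ => ?_
  cases u i <;> cases v i <;> simp [Fintype.sum_option] <;> ring

/-- The probability that `f` differs on two independent completions of `ρ` is at most
`2 (1 - bias)`. -/
lemma sum_completions_ne_le {n : ℕ} (ρ : Fin n → Option Bool) (f : (Fin n → Bool) → Bool) :
    ∑ y : Fin n → Bool, ∑ y' : Fin n → Bool, (∏ _i : Fin n, (1 / 4 : ℝ)) *
        (if f (fun i => (ρ i).getD (y i)) ≠ f (fun i => (ρ i).getD (y' i)) then 1 else 0) ≤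
      2 * (1 - restrictedBias ρ f) := by
  unfold restrictedBias
  set h : (Fin n → Bool) → Bool := fun y => f (fun i => (ρ i).getD (y i))
  set p : ℝ := ((Finset.univ.filter (fun y => h y = true)).card : ℝ) / 2 ^ n with hp
  set q : ℝ := ((Finset.univ.filter (fun y => h y = false)).card : ℝ) / 2 ^ n with hq
  have hp0 : 0 ≤ p := by positivity
  have hq0 : 0 ≤ q := by positivity
  have hP : p = ∑ y, (if h y = true then 1 else 0) / 2 ^ n := by
    rw [hp, ← Finset.sum_div, Finset.sum_boole]
  have hQ : q = ∑ y, (if h y = false then 1 else 0) / 2 ^ n := by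
    rw [hq, ← Finset.sum_div, Finset.sum_boole]
  have hpq : p + q = 1 := by
    rw [hP, hQ, ← Finset.sum_add_distrib]
    have : ∀ y, ((if h y = true then 1 else 0) / 2 ^ n + (if h y = false then 1 else 0) / 2 ^ n : ℝ)
        = 1 / 2 ^ n := by
      intro y
      cases h y <;> simp
    simp [this]
  have hsum : ∑ y : Fin n → Bool, ∑ y' : Fin n → Bool, (∏ _i : Fin n, (1 / 4 : ℝ)) *
      (if h y ≠ h y' then 1 else 0) = p * q + q * p := by
    have h4 : (∏ _i : Fin n, (1 / 4 : ℝ)) = 1 / 2 ^ n * (1 / 2 ^ n) := by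
      rw [Finset.prod_const, Finset.card_univ, Fintype.card_fin, ← one_div_pow, ← mul_pow]
      norm_num
    rw [h4, hP, hQ, Finset.sum_mul_sum, Finset.sum_mul_sum, ← Finset.sum_add_distrib]
    refine Finset.sum_congr rfl fun y _ => ?_
    rw [← Finset.sum_add_distrib]
    refine Finset.sum_congr rfl fun y' _ => ?_
    cases h y <;> cases h y' <;> simp
  refine hsum.trans_le ?_
  rcases max_cases p q with ⟨hm, _⟩ | ⟨hm, _⟩ <;> rw [hm] <;> nlinarith

/-- If `NS_{1-2δ}(f) ≤ 1 - s` with `δ ∈ [0,1/2]` and `s ∈ [0,1]`, then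
`ExpBias_{2δ}(f) ≤ 1 - s/4`. -/
theorem stmt18 {n : ℕ} (f : (Fin n → Bool) → Bool) (δ s : ℝ)
    (hδ0 : 0 ≤ δ) (hδ1 : δ ≤ 1 / 2) (hs0 : 0 ≤ s) (hs1 : s ≤ 1)
    (h : noiseStability (1 - 2 * δ) f ≤ 1 - s) :
    expBias (2 * δ) f ≤ 1 - s / 4 := by
  have key := sum_restriction_eq_sum_noise δ (fun a b => if f a ≠ f b then (1 : ℝ) else 0)
  have hbound : ∑ ρ : Fin n → Option Bool, ∑ y : Fin n → Bool, ∑ y' : Fin n → Bool,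
      (restrictionWeight (2 * δ) ρ * ∏ _i : Fin n, (1 / 4 : ℝ)) *
        (if f (fun i => (ρ i).getD (y i)) ≠ f (fun i => (ρ i).getD (y' i)) then (1 : ℝ) else 0) ≤
      ∑ ρ : Fin n → Option Bool, restrictionWeight (2 * δ) ρ * (2 * (1 - restrictedBias ρ f)) := by
    refine Finset.sum_le_sum fun ρ _ => ?_
    simp only [mul_assoc, ← Finset.mul_sum]
    simpa only [Finset.mul_sum] using mul_le_mul_of_nonneg_left (sum_completions_ne_le ρ f)
      (restrictionWeight_nonneg (by linarith) (by linarith) ρ)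
  have hexp : ∑ ρ : Fin n → Option Bool,
      restrictionWeight (2 * δ) ρ * (2 * (1 - restrictedBias ρ f)) =
      2 * (1 - expBias (2 * δ) f) := by
    simp only [mul_left_comm _ (2 : ℝ), ← Finset.mul_sum]
    simp only [mul_sub, mul_one, Finset.sum_sub_distrib, sum_restrictionWeight, expBias]
  unfold noiseStability at h
  rw [← key] at h
  linarith
end
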